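/- Let R_{ijkl} be an algebraic curvature tensor on ℝ^n and let 0 ≤ ν ≤ n. Then the trace of A_ν² on Λ^ν(ℝ^n) equals C(n−4, ν−2)·S² + [C(n−2, ν−1) − 4·C(n−4, ν−2)]·|Ric|² + C(n−4, ν−2)·|R|². -/

import Mathlib

open ExteriorAlgebra

/-- The wedge `e_{ι 0} ∧ ⋯ ∧ e_{ι (ν-1)}` of standard basis vectors of `ℝ^n`,
as an element of the `ν`-th exterior power `⋀[ℝ]^ν (ℝ^n)`. -/
noncomputable def stdWedge (n ν : ℕ) (ι : Fin ν → Fin n) : ⋀[ℝ]^ν (Fin n → ℝ) :=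
  ⟨ExteriorAlgebra.ιMulti ℝ ν (fun a => Pi.single (ι a) (1 : ℝ)),
   ExteriorAlgebra.ιMulti_range ℝ ν ⟨_, rfl⟩⟩

/-- The Ricci tensor `Ric_{ij} = ∑_p R_{ipjp}` of an algebraic curvature tensor
(indices raised with the Kronecker delta). -/
def ricci (n : ℕ) (R : Fin n → Fin n → Fin n → Fin n → ℝ) (i j : Fin n) : ℝ :=
  ∑ p : Fin n, R i p j p

/-- The scalar curvature `S = ∑_i Ric_{ii}`. -/
def scalarCurv (n : ℕ) (R : Fin n → Fin n → Fin n → Fin n → ℝ) : ℝ :=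
  ∑ i : Fin n, ricci n R i i

/-- Binomial coefficient `C(m, k)` defined for all integers, with the convention
that it vanishes if `m < 0`, `k < 0` or `m < k`. -/
def chooseZ (m k : ℤ) : ℤ :=
  if 0 ≤ m ∧ 0 ≤ k ∧ k ≤ m then (m.toNat.choose k.toNat : ℤ) else 0

/-- The value prescribed for the endomorphism `A_ν` of formula (7.2) of the paper on
the basis wedge `e_{ι 0} ∧ ⋯ ∧ e_{ι (ν-1)}`:
`A_ν = ∑_a A^a_ν − 2 ∑_{a<b} A^{ab}_ν`, where `A^a_ν` replaces the `a`-th factor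
`e_{i_a}` by `∑_p Ric_{i_a p} e_p`, and `A^{ab}_ν` replaces the factors `e_{i_a}`,
`e_{i_b}` by `e_p`, `e_q` with coefficient `R_{i_a p i_b q}`. -/
noncomputable def AnuVal (n ν : ℕ) (R : Fin n → Fin n → Fin n → Fin n → ℝ)
    (ι : Fin ν → Fin n) : ⋀[ℝ]^ν (Fin n → ℝ) :=
  (∑ a : Fin ν, ∑ p : Fin n,
      ricci n R (ι a) p • stdWedge n ν (Function.update ι a p)) -
    (2 : ℝ) • ∑ a : Fin ν, ∑ b : Fin ν,
      if a < b then
        ∑ p : Fin n, ∑ q : Fin n,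
          R (ι a) p (ι b) q •
            stdWedge n ν (Function.update (Function.update ι a p) b q)
      else 0


/-- Kronecker delta. -/
def kd {n : ℕ} (i j : Fin n) : ℝ := if i = j then 1 else 0

lemma kd_self {n : ℕ} (i : Fin n) : kd i i = 1 := by simp [kd]
lemma kd_ne {n : ℕ} {i j : Fin n} (h : i ≠ j) : kd i j = 0 := by simp [kd, h]

lemma sum4_ik {n : ℕ} (f : Fin n → Fin n → Fin n → Fin n → ℝ) :
    ∑ i, ∑ j, ∑ k, ∑ l, kd i k * f i j k l = ∑ i, ∑ j, ∑ l, f i j i l := by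
  simp_rw [← Finset.mul_sum, kd, ite_mul, one_mul, zero_mul, Finset.sum_ite_eq]
  simp

lemma sum4_il {n : ℕ} (f : Fin n → Fin n → Fin n → Fin n → ℝ) :
    ∑ i, ∑ j, ∑ k, ∑ l, kd i l * f i j k l = ∑ i, ∑ j, ∑ k, f i j k i := by
  simp_rw [kd, ite_mul, one_mul, zero_mul, Finset.sum_ite_eq]
  simp

lemma sum4_jk {n : ℕ} (f : Fin n → Fin n → Fin n → Fin n → ℝ) :
    ∑ i, ∑ j, ∑ k, ∑ l, kd j k * f i j k l = ∑ i, ∑ j, ∑ l, f i j j l := by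
  simp_rw [← Finset.mul_sum, kd, ite_mul, one_mul, zero_mul, Finset.sum_ite_eq]
  simp

lemma sum4_jl {n : ℕ} (f : Fin n → Fin n → Fin n → Fin n → ℝ) :
    ∑ i, ∑ j, ∑ k, ∑ l, kd j l * f i j k l = ∑ i, ∑ j, ∑ k, f i j k j := by
  simp_rw [kd, ite_mul, one_mul, zero_mul, Finset.sum_ite_eq]
  simp

lemma sum4_ikjl {n : ℕ} (f : Fin n → Fin n → Fin n → Fin n → ℝ) :
    ∑ i, ∑ j, ∑ k, ∑ l, kd i k * (kd j l * f i j k l) = ∑ i, ∑ j, f i j i j := by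
  rw [sum4_ik (fun i j k l => kd j l * f i j k l)]
  simp_rw [kd, ite_mul, one_mul, zero_mul, Finset.sum_ite_eq]
  simp

lemma sum4_iljk {n : ℕ} (f : Fin n → Fin n → Fin n → Fin n → ℝ) :
    ∑ i, ∑ j, ∑ k, ∑ l, kd i l * (kd j k * f i j k l) = ∑ i, ∑ j, f i j j i := by
  rw [sum4_il (fun i j k l => kd j k * f i j k l)]
  simp_rw [kd, ite_mul, one_mul, zero_mul, Finset.sum_ite_eq]
  simp

lemma sum4_mul {n : ℕ} (c : ℝ) (f : Fin n → Fin n → Fin n → Fin n → ℝ) :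
    ∑ i, ∑ j, ∑ k, ∑ l, c * f i j k l = c * ∑ i, ∑ j, ∑ k, ∑ l, f i j k l := by
  simp_rw [← Finset.mul_sum]

section Moments

variable {n : ℕ} {σ : Type*} [Fintype σ]

lemma moment_V (x : σ → Fin n → ℝ) (hx : ∀ s i, x s i * x s i = x s i) (N1 N2 : ℝ)
    (h1 : ∀ i j, i ≠ j → ∑ s, x s i * (1 - x s j) = N1)
    (h2 : ∀ i j k l, i ≠ j → k ≠ l → i ≠ k → i ≠ l → j ≠ k → j ≠ l →
      ∑ s, x s i * x s j * (1 - x s k) * (1 - x s l) = N2)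
    (i j k l : Fin n) (hij : i ≠ j) (hkl : k ≠ l) :
    ∑ s, (x s i - x s j) ^ 2 * (x s k - x s l) ^ 2 =
      4 * N2 * (1 - (kd i k + kd i l + kd j k + kd j l) + kd i k * kd j l + kd i l * kd j k)
      + N1 * (kd i k + kd i l + kd j k + kd j l) := by
  have three : ∀ a b c : Fin n, a ≠ b → a ≠ c → b ≠ c →
      ∑ s, (x s a - x s b) ^ 2 * (x s a - x s c) ^ 2 = N1 := by
    intro a b c hab hac hbc
    have e : ∀ s, (x s a - x s b) ^ 2 * (x s a - x s c) ^ 2 =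
        x s a * (1 - x s b) + (x s c * (1 - x s a) - x s c * (1 - x s b)) := by
      intro s
      have ha : x s a = 0 ∨ x s a = 1 := by
        have := hx s a
        rcases eq_or_ne (x s a) 0 with h | h
        · exact Or.inl h
        · exact Or.inr (mul_left_cancel₀ h (by rw [this, mul_one]))
      have hb := hx s b
      have hc := hx s c
      rcases ha with ha | ha <;> rw [ha]
      · linear_combination (x s c * x s c) * hb + x s b * hc
      · linear_combination (x s c ^2 - 2 * x s c + 1) * hb + (1 - x s b) * hc
    simp_rw [e]
    rw [Finset.sum_add_distrib, Finset.sum_sub_distrib, h1 a b hab, h1 c a hac.symm,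
      h1 c b hbc.symm]
    ring
  have two : ∑ s, (x s i - x s j) ^ 2 * (x s i - x s j) ^ 2 = 2 * N1 := by
    have e : ∀ s, (x s i - x s j) ^ 2 * (x s i - x s j) ^ 2 =
        x s i * (1 - x s j) + x s j * (1 - x s i) := by
      intro s
      have ha : x s i = 0 ∨ x s i = 1 := by
        have := hx s i
        rcases eq_or_ne (x s i) 0 with h | h
        · exact Or.inl h
        · exact Or.inr (mul_left_cancel₀ h (by rw [this, mul_one]))
      have hb := hx s j
      rcases ha with ha | ha <;> rw [ha]
      · linear_combination (x s j * x s j + x s j + 1) * hb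
      · linear_combination (x s j ^ 2 - 3 * x s j + 3) * hb
    simp_rw [e]
    rw [Finset.sum_add_distrib, h1 i j hij, h1 j i hij.symm]
    ring
  by_cases hik : i = k
  · subst hik
    by_cases hjl : j = l
    · subst hjl
      rw [two, kd_self, kd_self, kd_ne hij, kd_ne hij.symm]; ring
    · rw [three i j l hij hkl hjl, kd_self, kd_ne hkl, kd_ne hij.symm, kd_ne hjl]; ring
  · by_cases hil : i = l
    · subst hil
      by_cases hjk : j = k
      · subst hjk
        have : ∀ s, (x s i - x s j) ^ 2 * (x s j - x s i) ^ 2 =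
          (x s i - x s j) ^ 2 * (x s i - x s j) ^ 2 := fun s => by ring
        simp_rw [this]
        rw [two, kd_self, kd_self, kd_ne hij, kd_ne hij.symm]; ring
      · have : ∀ s, (x s i - x s j) ^ 2 * (x s k - x s i) ^ 2 =
          (x s i - x s j) ^ 2 * (x s i - x s k) ^ 2 := fun s => by ring
        simp_rw [this]
        rw [three i j k hij hik hjk, kd_self, kd_ne hik, kd_ne hij.symm, kd_ne hjk]; ring
    · by_cases hjk : j = k
      · subst hjk
        have : ∀ s, (x s i - x s j) ^ 2 * (x s j - x s l) ^ 2 =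
          (x s j - x s i) ^ 2 * (x s j - x s l) ^ 2 := fun s => by ring
        simp_rw [this]
        rw [three j i l hij.symm hkl hil, kd_self, kd_ne hij, kd_ne hil, kd_ne hkl]; ring
      · by_cases hjl : j = l
        · subst hjl
          have : ∀ s, (x s i - x s j) ^ 2 * (x s k - x s j) ^ 2 =
            (x s j - x s i) ^ 2 * (x s j - x s k) ^ 2 := fun s => by ring
          simp_rw [this]
          rw [three j i k hij.symm hjk hik, kd_self, kd_ne hij, kd_ne hik, kd_ne hjk]; ring
        · have e : ∀ s, (x s i - x s j) ^ 2 * (x s k - x s l) ^ 2 =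
              x s i * x s k * (1 - x s j) * (1 - x s l) + x s i * x s l * (1 - x s j) * (1 - x s k)
              + x s j * x s k * (1 - x s i) * (1 - x s l)
              + x s j * x s l * (1 - x s i) * (1 - x s k) := by
            intro s
            have e1 : (x s i - x s j) ^ 2 = x s i * (1 - x s j) + x s j * (1 - x s i) := by
              linear_combination hx s i + hx s j
            have e2 : (x s k - x s l) ^ 2 = x s k * (1 - x s l) + x s l * (1 - x s k) := by
              linear_combination hx s k + hx s l
            rw [e1, e2]; ring
          simp_rw [e, Finset.sum_add_distrib]
          rw [h2 i k j l, h2 i l j k, h2 j k i l, h2 j l i k,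
            kd_ne hik, kd_ne hil, kd_ne hjk, kd_ne hjl]
          · ring
          all_goals first | assumption | (apply Ne.symm; assumption)

lemma moment_U (x : σ → Fin n → ℝ) (hx : ∀ s i, x s i * x s i = x s i) (N1 N2 : ℝ)
    (h1 : ∀ i j, i ≠ j → ∑ s, x s i * (1 - x s j) = N1)
    (h2 : ∀ i j k l, i ≠ j → k ≠ l → i ≠ k → i ≠ l → j ≠ k → j ≠ l →
      ∑ s, x s i * x s j * (1 - x s k) * (1 - x s l) = N2)
    (i p k l : Fin n) (hik : i ≠ k) (hil : i ≠ l) (hpk : p ≠ k) (hpl : p ≠ l) :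
    ∑ s, x s i * (1 - x s p) * ((1 - 2 * x s k) * (1 - 2 * x s l)) =
      (1 - kd i p) * (N1 - 4 * N2 * (1 - kd k l)) := by
  by_cases hip : i = p
  · subst hip
    rw [kd_self]
    have : ∀ s, x s i * (1 - x s i) * ((1 - 2 * x s k) * (1 - 2 * x s l)) = 0 := by
      intro s
      have : x s i * (1 - x s i) = 0 := by linear_combination - hx s i
      rw [this]; ring
    simp [this]
  · rw [kd_ne hip]
    by_cases hkl : k = l
    · subst hkl
      rw [kd_self, ← h1 i p hip]
      have : ∀ s, x s i * (1 - x s p) * ((1 - 2 * x s k) * (1 - 2 * x s k)) =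
          x s i * (1 - x s p) := by
        intro s
        linear_combination (4 * x s i * (1 - x s p)) * hx s k
      simp_rw [this]; ring
    · rw [kd_ne hkl]
      have e : ∀ s, x s i * (1 - x s p) * ((1 - 2 * x s k) * (1 - 2 * x s l)) =
          x s i * (1 - x s p) - 2 * (x s i * x s k * (1 - x s p) * (1 - x s l))
          - 2 * (x s i * x s l * (1 - x s p) * (1 - x s k)) := by
        intro s; ring
      simp_rw [e, Finset.sum_sub_distrib, ← Finset.mul_sum]
      rw [h1 i p hip, h2 i k p l, h2 i l p k]
      · ring
      all_goals first | assumption | (apply Ne.symm; assumption)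

lemma moment_W (x : σ → Fin n → ℝ) (hx : ∀ s i, x s i * x s i = x s i) (N2 : ℝ)
    (h2 : ∀ i j k l, i ≠ j → k ≠ l → i ≠ k → i ≠ l → j ≠ k → j ≠ l →
      ∑ s, x s i * x s j * (1 - x s k) * (1 - x s l) = N2)
    (i j k l : Fin n) (hij : i ≠ j) (hkl : k ≠ l) :
    ∑ s, x s i * x s j * (1 - x s k) * (1 - x s l) =
      N2 * (1 - (kd i k + kd i l + kd j k + kd j l) + kd i k * kd j l + kd i l * kd j k) := by
  have z : ∀ s a, x s a * (1 - x s a) = 0 := fun s a => by linear_combination - hx s a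
  by_cases hik : i = k
  · subst hik
    have : ∀ s, x s i * x s j * (1 - x s i) * (1 - x s l) = 0 := fun s => by
      linear_combination (x s j * (1 - x s l)) * z s i
    simp_rw [this]
    by_cases hjl : j = l
    · subst hjl
      simp [kd, hij, hij.symm]
    · simp [kd, hij.symm, hjl, hkl]
  by_cases hil : i = l
  · subst hil
    have : ∀ s, x s i * x s j * (1 - x s k) * (1 - x s i) = 0 := fun s => by
      linear_combination (x s j * (1 - x s k)) * z s i
    simp_rw [this]
    by_cases hjk : j = k
    · subst hjk
      simp [kd, hij, hij.symm]
    · simp [kd, hij.symm, hjk, hik]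
  by_cases hjk : j = k
  · subst hjk
    have : ∀ s, x s i * x s j * (1 - x s j) * (1 - x s l) = 0 := fun s => by
      linear_combination (x s i * (1 - x s l)) * z s j
    simp [this, kd, hij, hil, hkl]
  by_cases hjl : j = l
  · subst hjl
    have : ∀ s, x s i * x s j * (1 - x s k) * (1 - x s j) = 0 := fun s => by
      linear_combination (x s i * (1 - x s k)) * z s j
    simp [this, kd, hij, hik, hjk]
  rw [h2 i j k l hij hkl hik hil hjk hjl]
  simp [kd, hik, hil, hjk, hjl]

lemma sum_T3 (x : σ → Fin n → ℝ) (hx : ∀ s i, x s i * x s i = x s i) (N2 : ℝ)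
    (h2 : ∀ i j k l, i ≠ j → k ≠ l → i ≠ k → i ≠ l → j ≠ k → j ≠ l →
      ∑ s, x s i * x s j * (1 - x s k) * (1 - x s l) = N2)
    (R : Fin n → Fin n → Fin n → Fin n → ℝ)
    (hskew₁ : ∀ i j k l, R i j k l = - R j i k l)
    (hskew₂ : ∀ i j k l, R i j k l = - R i j l k) :
    ∑ s, ∑ i, ∑ j, ∑ k, ∑ l, x s i * x s j * (1 - x s k) * (1 - x s l) * R i j k l ^ 2 =
      N2 * (∑ i, ∑ j, ∑ k, ∑ l, R i j k l ^ 2 - 4 * ∑ i, ∑ j, ∑ k, R i k j k ^ 2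
        + 2 * ∑ i, ∑ j, R i j i j ^ 2) := by
  have step : ∑ s, ∑ i, ∑ j, ∑ k, ∑ l, x s i * x s j * (1 - x s k) * (1 - x s l) * R i j k l ^ 2 =
      ∑ i, ∑ j, ∑ k, ∑ l, (N2 * R i j k l ^ 2
        - N2 * (kd i k * R i j k l ^ 2) - N2 * (kd i l * R i j k l ^ 2)
        - N2 * (kd j k * R i j k l ^ 2) - N2 * (kd j l * R i j k l ^ 2)
        + N2 * (kd i k * (kd j l * R i j k l ^ 2)) + N2 * (kd i l * (kd j k * R i j k l ^ 2))) := by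
    rw [Finset.sum_comm]; refine Finset.sum_congr rfl fun i _ => ?_
    rw [Finset.sum_comm]; refine Finset.sum_congr rfl fun j _ => ?_
    rw [Finset.sum_comm]; refine Finset.sum_congr rfl fun k _ => ?_
    rw [Finset.sum_comm]; refine Finset.sum_congr rfl fun l _ => ?_
    rw [← Finset.sum_mul]
    by_cases hij : i = j
    · subst hij
      have : R i i k l = 0 := by linarith [hskew₁ i i k l]
      simp [this]
    by_cases hkl : k = l
    · subst hkl
      have : R i j k k = 0 := by linarith [hskew₂ i j k k]
      simp [this]
    rw [moment_W x hx N2 h2 i j k l hij hkl]; ring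
  rw [step]
  simp only [Finset.sum_add_distrib, Finset.sum_sub_distrib, sum4_mul N2]
  rw [sum4_ik, sum4_il, sum4_jk, sum4_jl, sum4_ikjl, sum4_iljk]
  have a1 : ∑ i, ∑ j, ∑ l, R i j i l ^ 2 = ∑ i, ∑ j, ∑ k, R i k j k ^ 2 := by
    calc _ = ∑ j, ∑ i, ∑ l, R i j i l ^ 2 := Finset.sum_comm
      _ = ∑ j, ∑ l, ∑ i, R i j i l ^ 2 := Finset.sum_congr rfl fun _ _ => Finset.sum_comm
      _ = _ := by
        refine Finset.sum_congr rfl fun j _ => Finset.sum_congr rfl fun l _ =>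
          Finset.sum_congr rfl fun i _ => ?_
        rw [hskew₁, hskew₂]; ring
  have a2 : ∑ i, ∑ j, ∑ k, R i j k i ^ 2 = ∑ i, ∑ j, ∑ k, R i k j k ^ 2 := by
    rw [← a1]
    refine Finset.sum_congr rfl fun j _ => Finset.sum_congr rfl fun l _ =>
          Finset.sum_congr rfl fun i _ => ?_
    rw [hskew₂]; ring
  have a3 : ∑ i, ∑ j, ∑ l, R i j j l ^ 2 = ∑ i, ∑ j, ∑ k, R i k j k ^ 2 := by
    refine Finset.sum_congr rfl fun j _ => ?_
    rw [Finset.sum_comm]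
    refine Finset.sum_congr rfl fun l _ => Finset.sum_congr rfl fun i _ => ?_
    rw [hskew₂]; ring
  have a4 : ∑ i, ∑ j, ∑ k, R i j k j ^ 2 = ∑ i, ∑ j, ∑ k, R i k j k ^ 2 :=
    Finset.sum_congr rfl fun j _ => Finset.sum_comm
  have a5 : ∑ i, ∑ j, R i j j i ^ 2 = ∑ i, ∑ j, R i j i j ^ 2 := by
    refine Finset.sum_congr rfl fun j _ => Finset.sum_congr rfl fun l _ => ?_
    rw [hskew₂]; ring
  rw [a1, a2, a3, a4, a5]; ring

lemma sum_T1 (x : σ → Fin n → ℝ) (hx : ∀ s i, x s i * x s i = x s i) (N1 N2 : ℝ)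
    (h1 : ∀ i j, i ≠ j → ∑ s, x s i * (1 - x s j) = N1)
    (h2 : ∀ i j k l, i ≠ j → k ≠ l → i ≠ k → i ≠ l → j ≠ k → j ≠ l →
      ∑ s, x s i * x s j * (1 - x s k) * (1 - x s l) = N2)
    (K : Fin n → Fin n → ℝ) (hK : ∀ i j, K i j = K j i) (hK0 : ∀ i, K i i = 0) :
    ∑ s, (∑ i, ∑ j, x s i * (1 - x s j) * K i j) ^ 2 =
      N2 * ((∑ i, ∑ j, K i j) ^ 2 - 4 * ∑ i, (∑ j, K i j) ^ 2 + 2 * ∑ i, ∑ j, K i j ^ 2)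
      + N1 * ∑ i, (∑ j, K i j) ^ 2 := by
  have sq : ∀ f : Fin n → Fin n → ℝ,
      (∑ i, ∑ j, f i j) ^ 2 = ∑ i, ∑ j, ∑ k, ∑ l, f i j * f k l := by
    intro f
    simp_rw [pow_two, ← Finset.mul_sum, ← Finset.sum_mul]
  have hD : ∀ s, ∑ i, ∑ j, x s i * (1 - x s j) * K i j =
      ∑ i, ∑ j, (1 / 2) * (x s i - x s j) ^ 2 * K i j := by
    intro s
    have e : ∑ i, ∑ j, x s i * (1 - x s j) * K i j =
        ∑ i, ∑ j, x s j * (1 - x s i) * K i j := by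
      rw [Finset.sum_comm]
      refine Finset.sum_congr rfl fun j _ => Finset.sum_congr rfl fun l _ => ?_
      rw [hK]
    have e2 : ∑ i, ∑ j, (1 / 2) * (x s i - x s j) ^ 2 * K i j =
        (1/2) * ∑ i, ∑ j, x s i * (1 - x s j) * K i j
        + (1/2) * ∑ i, ∑ j, x s j * (1 - x s i) * K i j := by
      simp_rw [Finset.mul_sum, ← Finset.sum_add_distrib]
      refine Finset.sum_congr rfl fun i _ => Finset.sum_congr rfl fun j _ => ?_
      linear_combination (K i j / 2) * (hx s i + hx s j)
    rw [e2, ← e]; ring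
  have step : ∑ s, (∑ i, ∑ j, x s i * (1 - x s j) * K i j) ^ 2 =
      ∑ i, ∑ j, ∑ k, ∑ l, (N2 * (K i j * K k l)
        + (N1 / 4 - N2) * (kd i k * (K i j * K k l)) + (N1 / 4 - N2) * (kd i l * (K i j * K k l))
        + (N1 / 4 - N2) * (kd j k * (K i j * K k l)) + (N1 / 4 - N2) * (kd j l * (K i j * K k l))
        + N2 * (kd i k * (kd j l * (K i j * K k l)))
        + N2 * (kd i l * (kd j k * (K i j * K k l)))) := by
    simp_rw [hD, sq]
    rw [Finset.sum_comm]; refine Finset.sum_congr rfl fun i _ => ?_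
    rw [Finset.sum_comm]; refine Finset.sum_congr rfl fun j _ => ?_
    rw [Finset.sum_comm]; refine Finset.sum_congr rfl fun k _ => ?_
    rw [Finset.sum_comm]; refine Finset.sum_congr rfl fun l _ => ?_
    have e : ∀ s, 1 / 2 * (x s i - x s j) ^ 2 * K i j * (1 / 2 * (x s k - x s l) ^ 2 * K k l) =
      ((x s i - x s j) ^ 2 * (x s k - x s l) ^ 2) * (1 / 4 * K i j * K k l) := fun s => by ring
    simp_rw [e]
    rw [← Finset.sum_mul]
    by_cases hij : i = j
    · subst hij
      simp [hK0]
    by_cases hkl : k = l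
    · subst hkl
      simp [hK0]
    rw [moment_V x hx N1 N2 h1 h2 i j k l hij hkl]; ring
  rw [step]
  simp only [Finset.sum_add_distrib, sum4_mul N2, sum4_mul (N1 / 4 - N2)]
  rw [sum4_ik, sum4_il, sum4_jk, sum4_jl, sum4_ikjl, sum4_iljk, sq]
  have b1 : ∑ i, ∑ j, ∑ l, K i j * K i l = ∑ i, (∑ j, K i j) ^ 2 := by
    simp_rw [pow_two, Finset.sum_mul_sum]
  have b2 : ∑ i, ∑ j, ∑ k, K i j * K k i = ∑ i, (∑ j, K i j) ^ 2 := by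
    rw [← b1]; simp_rw [fun i k => hK k i]
  have b3 : ∑ i, ∑ j, ∑ l, K i j * K j l = ∑ i, (∑ j, K i j) ^ 2 := by
    rw [← b1, Finset.sum_comm]
    refine Finset.sum_congr rfl fun j _ => Finset.sum_congr rfl fun l _ => ?_
    rw [hK l j]
  have b4 : ∑ i, ∑ j, ∑ k, K i j * K k j = ∑ i, (∑ j, K i j) ^ 2 := by
    rw [← b1, Finset.sum_comm]
    refine Finset.sum_congr rfl fun j _ => Finset.sum_congr rfl fun l _ =>
      Finset.sum_congr rfl fun i _ => ?_
    rw [hK l j, hK i j]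
  have b5 : ∑ i, ∑ j, K i j * K j i = ∑ i, ∑ j, K i j ^ 2 := by
    refine Finset.sum_congr rfl fun j _ => Finset.sum_congr rfl fun l _ => ?_
    rw [hK l j]; ring
  have b6 : ∑ i, ∑ j, K i j * K i j = ∑ i, ∑ j, K i j ^ 2 := by
    simp_rw [pow_two]
  rw [b1, b2, b3, b4, b5, b6]
  ring

lemma sum_T2 (x : σ → Fin n → ℝ) (hx : ∀ s i, x s i * x s i = x s i) (N1 N2 : ℝ)
    (h1 : ∀ i j, i ≠ j → ∑ s, x s i * (1 - x s j) = N1)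
    (h2 : ∀ i j k l, i ≠ j → k ≠ l → i ≠ k → i ≠ l → j ≠ k → j ≠ l →
      ∑ s, x s i * x s j * (1 - x s k) * (1 - x s l) = N2)
    (R : Fin n → Fin n → Fin n → Fin n → ℝ)
    (hskew₁ : ∀ i j k l, R i j k l = - R j i k l)
    (hskew₂ : ∀ i j k l, R i j k l = - R i j l k) :
    ∑ s, ∑ i, ∑ p, x s i * (1 - x s p) * (∑ k, (1 - 2 * x s k) * R i k p k) ^ 2 =
      (N1 - 4 * N2) * (∑ i, ∑ j, ricci n R i j ^ 2 - ∑ i, ricci n R i i ^ 2)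
      + 4 * N2 * (∑ i, ∑ j, ∑ k, R i k j k ^ 2 - ∑ i, ∑ j, R i j i j ^ 2) := by
  have step : ∀ i p, ∑ s, x s i * (1 - x s p) * (∑ k, (1 - 2 * x s k) * R i k p k) ^ 2 =
      (1 - kd i p) * ((N1 - 4 * N2) * ricci n R i p ^ 2 + 4 * N2 * ∑ k, R i k p k ^ 2) := by
    intro i p
    have e : ∀ s, x s i * (1 - x s p) * (∑ k, (1 - 2 * x s k) * R i k p k) ^ 2 =
        ∑ k, ∑ l, (x s i * (1 - x s p) * ((1 - 2 * x s k) * (1 - 2 * x s l))) *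
          (R i k p k * R i l p l) := by
      intro s
      rw [pow_two, Finset.sum_mul_sum, Finset.mul_sum]
      refine Finset.sum_congr rfl fun k _ => ?_
      rw [Finset.mul_sum]
      refine Finset.sum_congr rfl fun l _ => ?_
      ring
    simp_rw [e]
    have e2 : ∑ s, ∑ k, ∑ l, (x s i * (1 - x s p) * ((1 - 2 * x s k) * (1 - 2 * x s l))) *
          (R i k p k * R i l p l) =
        ∑ k, ∑ l, ((1 - kd i p) * (N1 - 4 * N2) * (R i k p k * R i l p l)
          + (1 - kd i p) * (4 * N2) * (kd k l * (R i k p k * R i l p l))) := by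
      rw [Finset.sum_comm]; refine Finset.sum_congr rfl fun k _ => ?_
      rw [Finset.sum_comm]; refine Finset.sum_congr rfl fun l _ => ?_
      rw [← Finset.sum_mul]
      have z1 : ∀ a b c, R a a b c = 0 := fun a b c => by linarith [hskew₁ a a b c]
      have z2 : ∀ a b c, R a b c c = 0 := fun a b c => by linarith [hskew₂ a b c c]
      by_cases hik : i = k
      · subst hik; simp [z1]
      by_cases hil : i = l
      · subst hil; simp [z1]
      by_cases hpk : p = k
      · subst hpk; simp [z2]
      by_cases hpl : p = l
      · subst hpl; simp [z2]
      rw [moment_U x hx N1 N2 h1 h2 i p k l hik hil hpk hpl]; ring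
    rw [e2]
    simp only [Finset.sum_add_distrib, ← Finset.mul_sum]
    have e3 : ∑ k, ∑ l, kd k l * (R i k p k * R i l p l) = ∑ k, R i k p k ^ 2 := by
      simp_rw [kd, ite_mul, one_mul, zero_mul, Finset.sum_ite_eq, pow_two]
      simp
    rw [e3, ← Finset.sum_mul]
    simp only [ricci]
    ring
  rw [Finset.sum_comm]
  have : ∀ i, ∑ s, ∑ p, x s i * (1 - x s p) * (∑ k, (1 - 2 * x s k) * R i k p k) ^ 2
      = ∑ p, (1 - kd i p) * ((N1 - 4 * N2) * ricci n R i p ^ 2 + 4 * N2 * ∑ k, R i k p k ^ 2) := by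
    intro i
    rw [Finset.sum_comm]
    exact Finset.sum_congr rfl fun p _ => step i p
  simp_rw [this, sub_mul (1 : ℝ), one_mul, Finset.sum_sub_distrib]
  simp_rw [kd, ite_mul, one_mul, zero_mul, Finset.sum_ite_eq, Finset.mem_univ, if_true,
    Finset.sum_add_distrib, ← Finset.mul_sum]
  ring

/-- Summation over all index sets. -/
lemma sum_total (x : σ → Fin n → ℝ) (hx : ∀ s i, x s i * x s i = x s i) (N1 N2 : ℝ)
    (h1 : ∀ i j, i ≠ j → ∑ s, x s i * (1 - x s j) = N1)
    (h2 : ∀ i j k l, i ≠ j → k ≠ l → i ≠ k → i ≠ l → j ≠ k → j ≠ l →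
      ∑ s, x s i * x s j * (1 - x s k) * (1 - x s l) = N2)
    (R : Fin n → Fin n → Fin n → Fin n → ℝ)
    (hskew₁ : ∀ i j k l, R i j k l = - R j i k l)
    (hskew₂ : ∀ i j k l, R i j k l = - R i j l k) :
    ∑ s, ((∑ i, ∑ j, x s i * (1 - x s j) * R i j i j) ^ 2
      + ∑ i, ∑ p, x s i * (1 - x s p) * (∑ k, (1 - 2 * x s k) * R i k p k) ^ 2
      + ∑ i, ∑ j, ∑ k, ∑ l, x s i * x s j * (1 - x s k) * (1 - x s l) * R i j k l ^ 2) =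
      N2 * scalarCurv n R ^ 2 + (N1 - 4 * N2) * (∑ i, ∑ j, ricci n R i j ^ 2)
      + N2 * ∑ i, ∑ j, ∑ k, ∑ l, R i j k l ^ 2 := by
  rw [Finset.sum_add_distrib, Finset.sum_add_distrib,
    sum_T1 x hx N1 N2 h1 h2 (fun i j => R i j i j)
      (fun i j => by rw [hskew₁, hskew₂, neg_neg])
      (fun i => by linarith [hskew₁ i i i i]),
    sum_T2 x hx N1 N2 h1 h2 R hskew₁ hskew₂, sum_T3 x hx N2 h2 R hskew₁ hskew₂]
  have e1 : ∀ i, ∑ j, R i j i j = ricci n R i i := fun i => rfl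
  simp only [e1]
  have e2 : ∑ i, ricci n R i i = scalarCurv n R := rfl
  rw [e2]
  ring

end Moments

section Tuples

variable {n ν : ℕ}

/-- Alternating real functions of index tuples. -/
def Alt (L : (Fin ν → Fin n) → ℝ) : Prop :=
  (∀ κ c d, c ≠ d → κ c = κ d → L κ = 0) ∧
  (∀ κ c d, c ≠ d → L (κ ∘ Equiv.swap c d) = - L κ)

/-- Scalar version of the formula for `A_ν`. -/
noncomputable def opA (R : Fin n → Fin n → Fin n → Fin n → ℝ) (L : (Fin ν → Fin n) → ℝ)
    (κ : Fin ν → Fin n) : ℝ :=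
  (∑ a, ∑ p, ricci n R (κ a) p * L (Function.update κ a p)) -
    2 * ∑ a, ∑ b, if a < b then ∑ p, ∑ q, R (κ a) p (κ b) q *
      L (Function.update (Function.update κ a p) b q) else 0

lemma Alt.upd_swap {L : (Fin ν → Fin n) → ℝ} (hL : Alt L) (κ : Fin ν → Fin n) {c d : Fin ν}
    (h : c ≠ d) (r s : Fin n) :
    L (Function.update (Function.update κ c r) d s) =
      - L (Function.update (Function.update κ c s) d r) := by
  rw [← hL.2 _ c d h]
  congr 1
  ext e
  by_cases h1 : e = c
  · subst h1; simp [h]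
  · by_cases h2 : e = d
    · subst h2; simp [h]
    · simp [Equiv.swap_apply_of_ne_of_ne h1 h2, h1, h2]

lemma opA_eq {R : Fin n → Fin n → Fin n → Fin n → ℝ}
    (hskew₁ : ∀ i j k l, R i j k l = - R j i k l)
    (hskew₂ : ∀ i j k l, R i j k l = - R i j l k)
    (hbianchi : ∀ i j k l, R i j k l + R i k l j + R i l j k = 0)
    {L : (Fin ν → Fin n) → ℝ} (hL : Alt L) (κ : Fin ν → Fin n) :
    opA R L κ = (∑ a, ∑ p, ricci n R (κ a) p * L (Function.update κ a p)) -
      1 / 2 * ∑ a, ∑ b, ∑ p, ∑ q, R (κ a) (κ b) p q *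
        L (Function.update (Function.update κ a p) b q) := by
  set H : Fin ν → Fin ν → ℝ := fun a b => ∑ p, ∑ q, R (κ a) (κ b) p q *
        L (Function.update (Function.update κ a p) b q) with hH
  have H0 : ∀ a, H a a = 0 := by
    intro a
    have : ∀ p q, R (κ a) (κ a) p q = 0 := fun p q => by linarith [hskew₁ (κ a) (κ a) p q]
    simp [hH, this]
  have Hs : ∀ a b, H a b = H b a := by
    intro a b
    rcases eq_or_ne a b with rfl | hab
    · rfl
    simp only [hH]
    rw [Finset.sum_comm]
    refine Finset.sum_congr rfl fun q _ => Finset.sum_congr rfl fun p _ => ?_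
    rw [Function.update_comm hab, hskew₁, hskew₂]; ring
  have G : ∀ a b, a < b → ∑ p, ∑ q, R (κ a) p (κ b) q *
      L (Function.update (Function.update κ a p) b q) = 1 / 2 * H a b := by
    intro a b hab
    have e1 : ∑ p, ∑ q, R (κ a) p (κ b) q *
        L (Function.update (Function.update κ a p) b q) =
        ∑ p, ∑ q, - R (κ a) q (κ b) p *
        L (Function.update (Function.update κ a p) b q) := by
      rw [Finset.sum_comm]
      refine Finset.sum_congr rfl fun q _ => Finset.sum_congr rfl fun p _ => ?_
      rw [hL.upd_swap κ hab.ne]; ring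
    have e2 : H a b = ∑ p, ∑ q, R (κ a) p (κ b) q *
        L (Function.update (Function.update κ a p) b q) + ∑ p, ∑ q, - R (κ a) q (κ b) p *
        L (Function.update (Function.update κ a p) b q) := by
      simp only [hH, ← Finset.sum_add_distrib]
      refine Finset.sum_congr rfl fun q _ => Finset.sum_congr rfl fun p _ => ?_
      have h1 := hbianchi (κ a) (κ b) q p
      have h2 := hskew₂ (κ a) q p (κ b)
      rw [show R (κ a) (κ b) q p = R (κ a) q (κ b) p - R (κ a) p (κ b) q by linarith]
      ring
    rw [e2, ← e1]; ring
  have key : ∑ a, ∑ b, H a b = 2 * ∑ a, ∑ b, if a < b then H a b else 0 := by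
    have e1 : ∑ a, ∑ b, (if a < b then H a b else 0) = ∑ a, ∑ b, if b < a then H a b else 0 := by
      rw [Finset.sum_comm]
      refine Finset.sum_congr rfl fun q _ => Finset.sum_congr rfl fun p _ => ?_
      rw [Hs]
    have e2 : ∑ a, ∑ b, H a b = ∑ a, ∑ b, (if a < b then H a b else 0)
        + ∑ a, ∑ b, if b < a then H a b else 0 := by
      simp only [← Finset.sum_add_distrib]
      refine Finset.sum_congr rfl fun a _ => Finset.sum_congr rfl fun b _ => ?_
      rcases lt_trichotomy a b with h | h | h
      · simp [h, h.le, not_lt_of_gt h]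
      · subst h; simp [H0]
      · simp [h, h.le, not_lt_of_gt h]
    rw [e2, ← e1]; ring
  have e3 : ∑ a, ∑ b, (if a < b then ∑ p, ∑ q, R (κ a) p (κ b) q *
      L (Function.update (Function.update κ a p) b q) else 0) =
      1 / 2 * ∑ a, ∑ b, (if a < b then H a b else 0) := by
    simp only [Finset.mul_sum]
    refine Finset.sum_congr rfl fun a _ => Finset.sum_congr rfl fun b _ => ?_
    split_ifs with h
    · rw [G a b h]
    · simp
  rw [opA, e3, key]; ring

/-- Indicator function of the range of an index tuple. -/
def xr (ι : Fin ν → Fin n) (p : Fin n) : ℝ := if ∃ a, ι a = p then 1 else 0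

lemma xr_apply (ι : Fin ν → Fin n) (a : Fin ν) : xr ι (ι a) = 1 := by simp [xr]

lemma xr_not (ι : Fin ν → Fin n) {p : Fin n} (h : ¬ ∃ a, ι a = p) : xr ι p = 0 := by
  simp only [xr, h, if_false]

lemma sum_xr {ι : Fin ν → Fin n} (hι : Function.Injective ι) (f : Fin n → ℝ) :
    ∑ a, f (ι a) = ∑ i, xr ι i * f i := by
  simp only [xr, ite_mul, one_mul, zero_mul]
  rw [← Finset.sum_filter, ← Finset.sum_image (f := f) (s := Finset.univ) (g := ι)
    (fun _ _ _ _ h => hι h)]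
  congr 1
  ext; simp

lemma Alt.one {L : (Fin ν → Fin n) → ℝ} (hL : Alt L) {ι : Fin ν → Fin n}
    (a : Fin ν) (p : Fin n) :
    L (Function.update ι a p) = kd p (ι a) * L ι + (1 - xr ι p) * L (Function.update ι a p) := by
  by_cases hp : ∃ c, ι c = p
  · obtain ⟨c, rfl⟩ := hp
    rw [xr_apply]
    rcases eq_or_ne c a with rfl | hca
    · rw [Function.update_eq_self, kd_self]; ring
    · have z : L (Function.update ι a (ι c)) = 0 :=
        hL.1 _ a c hca.symm (by simp [hca])
      rw [z]
      by_cases h : ι c = ι a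
      · rw [← z, h, Function.update_eq_self, kd_self]; ring
      · rw [kd_ne h]; ring
  · have : p ≠ ι a := fun h => hp ⟨a, h.symm⟩
    rw [xr_not ι hp, kd_ne this]; ring

lemma Alt.two {L : (Fin ν → Fin n) → ℝ} (hL : Alt L) {ι : Fin ν → Fin n}
    (hι : Function.Injective ι) {a b : Fin ν} (hab : a ≠ b) (p q : Fin n) :
    L (Function.update (Function.update ι a p) b q) =
      L ι * (kd p (ι a) * kd q (ι b) - kd p (ι b) * kd q (ι a))
      + (1 - xr ι p) * kd q (ι b) * L (Function.update ι a p)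
      + (1 - xr ι q) * kd p (ι a) * L (Function.update ι b q)
      - (1 - xr ι p) * kd q (ι a) * L (Function.update ι b p)
      - (1 - xr ι q) * kd p (ι b) * L (Function.update ι a q)
      + (1 - xr ι p) * (1 - xr ι q) * L (Function.update (Function.update ι a p) b q) := by
  have hba := hab.symm
  have hia : ι a ≠ ι b := hι.ne hab
  have sw := hL.upd_swap ι hab
  have u1 : ∀ q, Function.update (Function.update ι a (ι a)) b q = Function.update ι b q :=
    fun q => by rw [Function.update_eq_self]
  have u2 : ∀ p, Function.update (Function.update ι a p) b (ι b) = Function.update ι a p :=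
    fun p => by rw [Function.update_comm hab, Function.update_eq_self]
  by_cases hp : ∃ c, ι c = p
  · obtain ⟨c, rfl⟩ := hp
    rw [xr_apply]
    rcases eq_or_ne c a with rfl | hca
    · rw [kd_self, kd_ne hia, u1]; linear_combination hL.one (ι := ι) b q
    rcases eq_or_ne c b with rfl | hcb
    · rw [kd_self, kd_ne hia.symm, sw, u2]; linear_combination - hL.one (ι := ι) a q
    rw [kd_ne (hι.ne hca), kd_ne (hι.ne hcb),
      hL.1 (Function.update (Function.update ι a (ι c)) b q) a c hca.symm (by simp [hab, hca, hcb])]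
    ring
  · have h1 : p ≠ ι a := fun h => hp ⟨a, h.symm⟩
    have h2 : p ≠ ι b := fun h => hp ⟨b, h.symm⟩
    rw [xr_not ι hp, kd_ne h1, kd_ne h2]
    by_cases hq : ∃ c, ι c = q
    · obtain ⟨c, rfl⟩ := hq
      rw [xr_apply]
      rcases eq_or_ne c a with rfl | hca
      · rw [kd_self, kd_ne hia, sw, u1]; ring
      rcases eq_or_ne c b with rfl | hcb
      · rw [kd_self, kd_ne hia.symm, u2]; ring
      rw [kd_ne (hι.ne hca), kd_ne (hι.ne hcb),
        hL.1 (Function.update (Function.update ι a p) b (ι c)) b c hcb.symm (by simp [hca, hcb])]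
      ring
    · have h3 : q ≠ ι a := fun h => hq ⟨a, h.symm⟩
      have h4 : q ≠ ι b := fun h => hq ⟨b, h.symm⟩
      rw [xr_not ι hq, kd_ne h3, kd_ne h4]; ring

lemma sum_kd {m : ℕ} (i : Fin m) (f : Fin m → ℝ) : ∑ p, kd p i * f p = f i := by
  simp [kd]

lemma opA_expand {R : Fin n → Fin n → Fin n → Fin n → ℝ}
    (hskew₁ : ∀ i j k l, R i j k l = - R j i k l)
    (hskew₂ : ∀ i j k l, R i j k l = - R i j l k)
    (hbianchi : ∀ i j k l, R i j k l + R i k l j + R i l j k = 0)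
    {L : (Fin ν → Fin n) → ℝ} (hL : Alt L) {ι : Fin ν → Fin n} (hι : Function.Injective ι) :
    opA R L ι = L ι * (∑ a, ricci n R (ι a) (ι a) - ∑ a, ∑ b, R (ι a) (ι b) (ι a) (ι b))
      + ∑ a, ∑ p, (1 - xr ι p) * (ricci n R (ι a) p - 2 * ∑ b, R (ι a) (ι b) p (ι b)) *
          L (Function.update ι a p)
      - 1 / 2 * ∑ a, ∑ b, ∑ p, ∑ q, (1 - xr ι p) * (1 - xr ι q) * (R (ι a) (ι b) p q *
        L (Function.update (Function.update ι a p) b q)) := by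
  have z1 : ∀ i k l, R i i k l = 0 := fun i k l => by linarith [hskew₁ i i k l]
  rw [opA_eq hskew₁ hskew₂ hbianchi hL]
  have s1 : ∀ a, ∑ p, ricci n R (ι a) p * L (Function.update ι a p) =
      L ι * ricci n R (ι a) (ι a) + ∑ p, (1 - xr ι p) * (ricci n R (ι a) p *
          L (Function.update ι a p)) := by
    intro a
    rw [← sum_kd (ι a) (fun p => ricci n R (ι a) p), Finset.mul_sum, ← Finset.sum_add_distrib]
    refine Finset.sum_congr rfl fun p _ => ?_
    linear_combination (ricci n R (ι a) p) * hL.one (ι := ι) a p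
  have s2 : ∀ a b, ∑ p, ∑ q, R (ι a) (ι b) p q *
        L (Function.update (Function.update ι a p) b q) =
      2 * L ι * R (ι a) (ι b) (ι a) (ι b)
      + 2 * ∑ p, (1 - xr ι p) * (R (ι a) (ι b) p (ι b) * L (Function.update ι a p))
      + 2 * ∑ p, (1 - xr ι p) * (R (ι b) (ι a) p (ι a) * L (Function.update ι b p))
      + ∑ p, ∑ q, (1 - xr ι p) * (1 - xr ι q) * (R (ι a) (ι b) p q *
        L (Function.update (Function.update ι a p) b q)) := by
    intro a b
    rcases eq_or_ne a b with rfl | hab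
    · simp [z1]
    have e : ∀ p q, R (ι a) (ι b) p q * L (Function.update (Function.update ι a p) b q) =
        kd p (ι a) * (kd q (ι b) * (L ι * R (ι a) (ι b) p q))
        - kd p (ι b) * (kd q (ι a) * (L ι * R (ι a) (ι b) p q))
        + kd q (ι b) * ((1 - xr ι p) * (R (ι a) (ι b) p q * L (Function.update ι a p)))
        + kd p (ι a) * ((1 - xr ι q) * (R (ι a) (ι b) p q * L (Function.update ι b q)))
        - kd q (ι a) * ((1 - xr ι p) * (R (ι a) (ι b) p q * L (Function.update ι b p)))
        - kd p (ι b) * ((1 - xr ι q) * (R (ι a) (ι b) p q * L (Function.update ι a q)))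
        + (1 - xr ι p) * (1 - xr ι q) * (R (ι a) (ι b) p q *
          L (Function.update (Function.update ι a p) b q)) := by
      intro p q
      linear_combination (R (ι a) (ι b) p q) * hL.two hι hab p q
    rw [Finset.sum_congr rfl fun p _ => Finset.sum_congr rfl fun q _ => e p q]
    simp only [Finset.sum_add_distrib, Finset.sum_sub_distrib]
    have k1 : ∀ (i : Fin n) (f : Fin n → Fin n → ℝ),
        ∑ p, ∑ q, kd p i * f p q = ∑ q, f i q := by
      intro i f
      simp_rw [← Finset.mul_sum]
      exact sum_kd i (fun p => ∑ q, f p q)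
    have k2 : ∀ (i : Fin n) (f : Fin n → Fin n → ℝ),
        ∑ p, ∑ q, kd q i * f p q = ∑ p, f p i := by
      intro i f
      exact Finset.sum_congr rfl fun p _ => sum_kd i (f p)
    rw [k1 (ι a) (fun p q => kd q (ι b) * (L ι * R (ι a) (ι b) p q)),
      k1 (ι b) (fun p q => kd q (ι a) * (L ι * R (ι a) (ι b) p q)), sum_kd, sum_kd,
      k2 (ι b) (fun p q => (1 - xr ι p) * (R (ι a) (ι b) p q * L (Function.update ι a p))),
      k2 (ι a) (fun p q => (1 - xr ι p) * (R (ι a) (ι b) p q * L (Function.update ι b p))),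
      k1 (ι a) (fun p q => (1 - xr ι q) * (R (ι a) (ι b) p q * L (Function.update ι b q))),
      k1 (ι b) (fun p q => (1 - xr ι q) * (R (ι a) (ι b) p q * L (Function.update ι a q)))]
    have f1 : ∑ q, (1 - xr ι q) * (R (ι a) (ι b) (ι b) q * L (Function.update ι a q)) =
        - ∑ p, (1 - xr ι p) * (R (ι a) (ι b) p (ι b) * L (Function.update ι a p)) := by
      rw [← Finset.sum_neg_distrib]
      refine Finset.sum_congr rfl fun p _ => ?_
      rw [hskew₂]; ring
    have f2 : ∑ q, (1 - xr ι q) * (R (ι a) (ι b) (ι a) q * L (Function.update ι b q)) =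
        ∑ p, (1 - xr ι p) * (R (ι b) (ι a) p (ι a) * L (Function.update ι b p)) := by
      refine Finset.sum_congr rfl fun p _ => ?_
      rw [hskew₁, hskew₂]; ring
    have f3 : ∑ q, (1 - xr ι q) * (R (ι a) (ι b) q (ι a) * L (Function.update ι b q)) =
        - ∑ p, (1 - xr ι p) * (R (ι b) (ι a) p (ι a) * L (Function.update ι b p)) := by
      rw [← Finset.sum_neg_distrib]
      refine Finset.sum_congr rfl fun p _ => ?_
      rw [hskew₁]; ring
    rw [f1, f2, f3, hskew₂ (ι a) (ι b) (ι b) (ι a)]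
    ring
  simp_rw [s1, s2]
  simp only [Finset.sum_add_distrib, ← Finset.mul_sum]
  have c1 : ∑ a, ∑ b, ∑ p, (1 - xr ι p) * (R (ι b) (ι a) p (ι a) * L (Function.update ι b p)) =
      ∑ a, ∑ b, ∑ p, (1 - xr ι p) * (R (ι a) (ι b) p (ι b) * L (Function.update ι a p)) :=
    Finset.sum_comm
  have c2 : ∑ a, ∑ p, (1 - xr ι p) * (ricci n R (ι a) p - 2 * ∑ b, R (ι a) (ι b) p (ι b)) *
          L (Function.update ι a p) =
      ∑ a, ∑ p, (1 - xr ι p) * (ricci n R (ι a) p * L (Function.update ι a p)) -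
      2 * ∑ a, ∑ b, ∑ p, (1 - xr ι p) * (R (ι a) (ι b) p (ι b) * L (Function.update ι a p)) := by
    rw [Finset.mul_sum, ← Finset.sum_sub_distrib]
    refine Finset.sum_congr rfl fun a _ => ?_
    rw [Finset.sum_comm, Finset.mul_sum, ← Finset.sum_sub_distrib]
    refine Finset.sum_congr rfl fun p _ => ?_
    simp_rw [← mul_assoc, ← Finset.sum_mul, ← Finset.mul_sum]
    ring
  rw [c1, c2]
  ring

section Mu

lemma mu_one {μ : (Fin ν → Fin n) → ℝ} (hμ : Alt μ) {ι : Fin ν → Fin n}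
    (m1 : μ ι = 1) (m2 : ∀ κ c, (¬ ∃ a, ι a = κ c) → μ κ = 0) (a : Fin ν) (r : Fin n) :
    μ (Function.update ι a r) = kd r (ι a) := by
  by_cases hr : ∃ c, ι c = r
  · rw [hμ.one a r, m1]
    obtain ⟨c, rfl⟩ := hr
    rw [xr_apply]; ring
  · rw [m2 _ a (by simpa using hr), kd_ne]
    exact fun h => hr ⟨a, h.symm⟩

lemma mu_two {μ : (Fin ν → Fin n) → ℝ} (hμ : Alt μ) {ι : Fin ν → Fin n}
    (hι : Function.Injective ι)
    (m1 : μ ι = 1) (m2 : ∀ κ c, (¬ ∃ a, ι a = κ c) → μ κ = 0) {a b : Fin ν} (hab : a ≠ b)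
    (r s : Fin n) :
    μ (Function.update (Function.update ι a r) b s) =
      kd r (ι a) * kd s (ι b) - kd r (ι b) * kd s (ι a) := by
  by_cases hr : ∃ c, ι c = r
  · by_cases hs : ∃ c, ι c = s
    · rw [hμ.two hι hab r s, m1]
      obtain ⟨c, rfl⟩ := hr
      obtain ⟨d, rfl⟩ := hs
      rw [xr_apply, xr_apply]; ring
    · rw [m2 _ b (by simpa using hs), kd_ne (i := s) (j := ι b), kd_ne (i := s) (j := ι a)]
      · ring
      · exact fun h => hs ⟨a, h.symm⟩
      · exact fun h => hs ⟨b, h.symm⟩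
  · rw [m2 _ a (by simpa [hab] using hr), kd_ne (i := r) (j := ι a), kd_ne (i := r) (j := ι b)]
    · ring
    · exact fun h => hr ⟨b, h.symm⟩
    · exact fun h => hr ⟨a, h.symm⟩

lemma mu_sum {R : Fin n → Fin n → Fin n → Fin n → ℝ}
    (hskew₂ : ∀ i j k l, R i j k l = - R i j l k)
    {μ : (Fin ν → Fin n) → ℝ} (hμ : Alt μ) {ι : Fin ν → Fin n}
    (hι : Function.Injective ι)
    (m1 : μ ι = 1) (m2 : ∀ κ c, (¬ ∃ a, ι a = κ c) → μ κ = 0) {a b : Fin ν} (hab : a ≠ b)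
    (u v : Fin n) :
    ∑ r, ∑ s, R u v r s * μ (Function.update (Function.update ι a r) b s) =
      2 * R u v (ι a) (ι b) := by
  simp_rw [mu_two hμ hι m1 m2 hab]
  have e : ∀ r s, R u v r s * (kd r (ι a) * kd s (ι b) - kd r (ι b) * kd s (ι a)) =
    kd r (ι a) * (kd s (ι b) * R u v r s) - kd r (ι b) * (kd s (ι a) * R u v r s) :=
    fun r s => by ring
  simp_rw [e, Finset.sum_sub_distrib, ← Finset.mul_sum, sum_kd]
  rw [hskew₂ u v (ι b) (ι a)]; ring

lemma M_zero {R : Fin n → Fin n → Fin n → Fin n → ℝ}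
    (hskew₁ : ∀ i j k l, R i j k l = - R j i k l)
    (hskew₂ : ∀ i j k l, R i j k l = - R i j l k)
    (hbianchi : ∀ i j k l, R i j k l + R i k l j + R i l j k = 0)
    {μ : (Fin ν → Fin n) → ℝ} (hμ : Alt μ) {ι : Fin ν → Fin n} (hι : Function.Injective ι)
    (m1 : μ ι = 1) (m2 : ∀ κ c, (¬ ∃ a, ι a = κ c) → μ κ = 0) :
    opA R μ ι = ∑ a, ricci n R (ι a) (ι a) - ∑ a, ∑ b, R (ι a) (ι b) (ι a) (ι b) := by
  rw [opA_eq hskew₁ hskew₂ hbianchi hμ]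
  have e1 : ∀ a, ∑ p, ricci n R (ι a) p * μ (Function.update ι a p) = ricci n R (ι a) (ι a) := by
    intro a
    simp_rw [mu_one hμ m1 m2 a, mul_comm (ricci n R (ι a) _), sum_kd]
  have e2 : ∀ a b, ∑ p, ∑ q, R (ι a) (ι b) p q *
        μ (Function.update (Function.update ι a p) b q) = 2 * R (ι a) (ι b) (ι a) (ι b) := by
    intro a b
    rcases eq_or_ne a b with rfl | hab
    · have z1 : ∀ i k l, R i i k l = 0 := fun i k l => by linarith [hskew₁ i i k l]
      simp [z1]
    · exact mu_sum hskew₂ hμ hι m1 m2 hab _ _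
  simp_rw [e1, e2, ← Finset.mul_sum]; ring

lemma M_one {R : Fin n → Fin n → Fin n → Fin n → ℝ}
    (hskew₁ : ∀ i j k l, R i j k l = - R j i k l)
    (hskew₂ : ∀ i j k l, R i j k l = - R i j l k)
    (hbianchi : ∀ i j k l, R i j k l + R i k l j + R i l j k = 0)
    {μ : (Fin ν → Fin n) → ℝ} (hμ : Alt μ) {ι : Fin ν → Fin n} (hι : Function.Injective ι)
    (m1 : μ ι = 1) (m2 : ∀ κ c, (¬ ∃ a, ι a = κ c) → μ κ = 0)
    (a : Fin ν) {p : Fin n} (hp : ¬ ∃ c, ι c = p) :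
    opA R μ (Function.update ι a p) =
      ricci n R p (ι a) - 2 * ∑ b, R p (ι b) (ι a) (ι b) := by
  rw [opA_eq hskew₁ hskew₂ hbianchi hμ]
  have z1 : ∀ i k l, R i i k l = 0 := fun i k l => by linarith [hskew₁ i i k l]
  have z2 : ∀ i j k, R i j k k = 0 := fun i j k => by linarith [hskew₂ i j k k]
  have e1 : ∀ c, ∑ r, ricci n R (Function.update ι a p c) r *
      μ (Function.update (Function.update ι a p) c r) = kd c a * ricci n R p (ι a) := by
    intro c
    rcases eq_or_ne c a with rfl | hc
    · simp_rw [Function.update_idem, mu_one hμ m1 m2 c, Function.update_self,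
        mul_comm (ricci n R p _), sum_kd]
      rw [kd_self, one_mul]
    · rw [kd_ne hc, zero_mul]
      refine Finset.sum_eq_zero fun r _ => ?_
      rw [m2 _ a (by simpa [hc.symm] using hp), mul_zero]
  have e2 : ∀ c d, ∑ r, ∑ s, R (Function.update ι a p c) (Function.update ι a p d) r s *
        μ (Function.update (Function.update (Function.update ι a p) c r) d s) =
        kd c a * (2 * R p (ι d) (ι a) (ι d)) + kd d a * (2 * R p (ι c) (ι a) (ι c)) := by
    intro c d
    rcases eq_or_ne c a with rfl | hc
    · rcases eq_or_ne d c with rfl | hd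
      · simp [z1, z2]
      · simp_rw [Function.update_idem, Function.update_self, Function.update_of_ne hd]
        rw [mu_sum hskew₂ hμ hι m1 m2 hd.symm, kd_self, kd_ne hd]; ring
    · rcases eq_or_ne d a with rfl | hd
      · have : ∀ r s, Function.update (Function.update (Function.update ι d p) c r) d s =
          Function.update (Function.update ι c r) d s := by
          intro r s
          rw [Function.update_comm hc.symm, Function.update_idem]
        simp_rw [this, Function.update_self, Function.update_of_ne hc]
        rw [mu_sum hskew₂ hμ hι m1 m2 hc, kd_self, kd_ne hc, hskew₁, hskew₂]; ring
      · rw [kd_ne hc, kd_ne hd, zero_mul, zero_mul, add_zero]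
        refine Finset.sum_eq_zero fun r _ => Finset.sum_eq_zero fun s _ => ?_
        rw [m2 _ a (by simpa [hc.symm, hd.symm] using hp), mul_zero]
  simp_rw [e1, e2, Finset.sum_add_distrib, sum_kd, ← Finset.mul_sum]
  rw [sum_kd a (fun _ => 2 * ∑ i, R p (ι i) (ι a) (ι i))]; ring

lemma M_two {R : Fin n → Fin n → Fin n → Fin n → ℝ}
    (hskew₁ : ∀ i j k l, R i j k l = - R j i k l)
    (hskew₂ : ∀ i j k l, R i j k l = - R i j l k)
    (hbianchi : ∀ i j k l, R i j k l + R i k l j + R i l j k = 0)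
    {μ : (Fin ν → Fin n) → ℝ} (hμ : Alt μ) {ι : Fin ν → Fin n} (hι : Function.Injective ι)
    (m1 : μ ι = 1) (m2 : ∀ κ c, (¬ ∃ a, ι a = κ c) → μ κ = 0)
    {a b : Fin ν} (hab : a ≠ b) {p q : Fin n} (hp : ¬ ∃ c, ι c = p) (hq : ¬ ∃ c, ι c = q) :
    opA R μ (Function.update (Function.update ι a p) b q) = -2 * R p q (ι a) (ι b) := by
  rw [opA_eq hskew₁ hskew₂ hbianchi hμ]
  have z1 : ∀ i k l, R i i k l = 0 := fun i k l => by linarith [hskew₁ i i k l]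
  have hba := hab.symm
  set κ := Function.update (Function.update ι a p) b q with hκ
  have ka : κ a = p := by simp [hκ, hab]
  have kb : κ b = q := by simp [hκ]
  have e1 : ∀ c, ∑ r, ricci n R (κ c) r * μ (Function.update κ c r) = 0 := by
    intro c
    refine Finset.sum_eq_zero fun r _ => ?_
    rcases eq_or_ne c a with rfl | hc
    · rw [m2 _ b (by rw [Function.update_of_ne hba, kb]; exact hq), mul_zero]
    · rw [m2 _ a (by rw [Function.update_of_ne hc.symm, ka]; exact hp), mul_zero]
  have e2 : ∀ c d, ∑ r, ∑ s, R (κ c) (κ d) r s *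
        μ (Function.update (Function.update κ c r) d s) =
        kd c a * (kd d b * (2 * R p q (ι a) (ι b))) +
        kd c b * (kd d a * (2 * R p q (ι a) (ι b))) := by
    intro c d
    rcases eq_or_ne c d with rfl | hcd
    · simp only [z1, zero_mul, Finset.sum_const_zero]
      rcases eq_or_ne c a with rfl | hc
      · rw [kd_ne hab]; ring
      · rw [kd_ne hc]; ring
    by_cases hda : a = c ∨ a = d
    · by_cases hdb : b = c ∨ b = d
      · rcases hda with rfl | rfl
        · obtain rfl : b = d := hdb.resolve_left hba
          have : ∀ r s, Function.update (Function.update κ a r) b s =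
              Function.update (Function.update ι a r) b s := by
            intro r s
            rw [hκ, Function.update_comm hab, Function.update_idem, Function.update_comm hba,
              Function.update_idem]
          simp_rw [this, ka, kb]
          rw [mu_sum hskew₂ hμ hι m1 m2 hab, kd_self, kd_self, kd_ne hab]; ring
        · obtain rfl : b = c := hdb.resolve_right hba
          have : ∀ r s, Function.update (Function.update κ b r) a s =
              Function.update (Function.update ι b r) a s := by
            intro r s
            rw [hκ, Function.update_idem, Function.update_comm hab, Function.update_idem]
          simp_rw [this, ka, kb]
          rw [mu_sum hskew₂ hμ hι m1 m2 hba, kd_self, kd_self, kd_ne hab, kd_ne hba, hskew₁,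
            hskew₂]
          ring
      · push Not at hdb
        rw [kd_ne hdb.1.symm, kd_ne hdb.2.symm]
        simp only [zero_mul, mul_zero, add_zero]
        refine Finset.sum_eq_zero fun r _ => Finset.sum_eq_zero fun s _ => ?_
        rw [m2 _ b (by
          rw [Function.update_of_ne hdb.2, Function.update_of_ne hdb.1, kb]; exact hq), mul_zero]
    · push Not at hda
      rw [kd_ne hda.1.symm, kd_ne hda.2.symm]
      simp only [zero_mul, mul_zero, add_zero]
      refine Finset.sum_eq_zero fun r _ => Finset.sum_eq_zero fun s _ => ?_
      rw [m2 _ a (by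
        rw [Function.update_of_ne hda.2, Function.update_of_ne hda.1, ka]; exact hp), mul_zero]
  simp_rw [e1, e2, Finset.sum_add_distrib, ← Finset.mul_sum]
  simp only [sum_kd, Finset.sum_const_zero]
  ring

lemma xr_cases (ι : Fin ν → Fin n) {p : Fin n} {u v : ℝ} (h : (¬ ∃ c, ι c = p) → u = v) :
    (1 - xr ι p) * u = (1 - xr ι p) * v := by
  by_cases hp : ∃ c, ι c = p
  · obtain ⟨c, rfl⟩ := hp
    rw [xr_apply]; ring
  · rw [h hp]

lemma per_set {R : Fin n → Fin n → Fin n → Fin n → ℝ}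
    (hskew₁ : ∀ i j k l, R i j k l = - R j i k l)
    (hskew₂ : ∀ i j k l, R i j k l = - R i j l k)
    (hpair : ∀ i j k l, R i j k l = R k l i j)
    (hbianchi : ∀ i j k l, R i j k l + R i k l j + R i l j k = 0)
    {μ : (Fin ν → Fin n) → ℝ} (hμ : Alt μ) (hM : Alt (opA R μ))
    {ι : Fin ν → Fin n} (hι : Function.Injective ι)
    (m1 : μ ι = 1) (m2 : ∀ κ c, (¬ ∃ a, ι a = κ c) → μ κ = 0) :
    opA R (opA R μ) ι =
      (∑ i, ∑ j, xr ι i * (1 - xr ι j) * R i j i j) ^ 2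
      + ∑ i, ∑ p, xr ι i * (1 - xr ι p) * (∑ k, (1 - 2 * xr ι k) * R i k p k) ^ 2
      + ∑ i, ∑ j, ∑ k, ∑ l, xr ι i * xr ι j * (1 - xr ι k) * (1 - xr ι l) * R i j k l ^ 2 := by
  have z1 : ∀ i k l, R i i k l = 0 := fun i k l => by linarith [hskew₁ i i k l]
  have F : ∀ i p, ricci n R i p - 2 * ∑ b, R i (ι b) p (ι b) =
      ∑ k, (1 - 2 * xr ι k) * R i k p k := by
    intro i p
    rw [sum_xr hι (fun k => R i k p k), ricci, Finset.mul_sum, ← Finset.sum_sub_distrib]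
    exact Finset.sum_congr rfl fun k _ => by ring
  have F2 : ∀ i p, ∑ k, (1 - 2 * xr ι k) * R i k p k = ∑ k, (1 - 2 * xr ι k) * R p k i k :=
    fun i p => Finset.sum_congr rfl fun k _ => by rw [hpair]
  have D : ∑ a, ricci n R (ι a) (ι a) - ∑ a, ∑ b, R (ι a) (ι b) (ι a) (ι b) =
      ∑ i, ∑ j, xr ι i * (1 - xr ι j) * R i j i j := by
    rw [sum_xr hι (fun i => ricci n R i i), sum_xr hι (fun i => ∑ b, R i (ι b) i (ι b)),
      ← Finset.sum_sub_distrib]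
    refine Finset.sum_congr rfl fun i _ => ?_
    rw [sum_xr hι (fun j => R i j i j), ricci, ← mul_sub, ← Finset.sum_sub_distrib, Finset.mul_sum]
    exact Finset.sum_congr rfl fun k _ => by ring
  rw [opA_expand hskew₁ hskew₂ hbianchi hM hι, M_zero hskew₁ hskew₂ hbianchi hμ hι m1 m2, D]
  have t1 : ∑ a, ∑ p, (1 - xr ι p) * (ricci n R (ι a) p - 2 * ∑ b, R (ι a) (ι b) p (ι b)) *
      opA R μ (Function.update ι a p) =
      ∑ i, ∑ p, xr ι i * (1 - xr ι p) * (∑ k, (1 - 2 * xr ι k) * R i k p k) ^ 2 := by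
    have : ∀ i, ∑ p, xr ι i * (1 - xr ι p) * (∑ k, (1 - 2 * xr ι k) * R i k p k) ^ 2 =
        xr ι i * ∑ p, (1 - xr ι p) * (∑ k, (1 - 2 * xr ι k) * R i k p k) ^ 2 := fun i => by
      rw [Finset.mul_sum]; exact Finset.sum_congr rfl fun k _ => by ring
    simp_rw [this]
    rw [← sum_xr hι (fun i => ∑ p, (1 - xr ι p) * (∑ k, (1 - 2 * xr ι k) * R i k p k) ^ 2)]
    refine Finset.sum_congr rfl fun a _ => Finset.sum_congr rfl fun p _ => ?_
    rw [mul_assoc]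
    refine xr_cases ι fun hp => ?_
    rw [M_one hskew₁ hskew₂ hbianchi hμ hι m1 m2 a hp, F, F, F2 p, sq]
  have t2 : ∑ a, ∑ b, ∑ p, ∑ q, (1 - xr ι p) * (1 - xr ι q) * (R (ι a) (ι b) p q *
        opA R μ (Function.update (Function.update ι a p) b q)) =
      -2 * ∑ i, ∑ j, ∑ k, ∑ l,
        xr ι i * xr ι j * (1 - xr ι k) * (1 - xr ι l) * R i j k l ^ 2 := by
    have h1 : ∀ i, ∑ j, ∑ k, ∑ l,
        xr ι i * xr ι j * (1 - xr ι k) * (1 - xr ι l) * R i j k l ^ 2 =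
        xr ι i * ∑ b, ∑ k, ∑ l, (1 - xr ι k) * (1 - xr ι l) * R i (ι b) k l ^ 2 := by
      intro i
      rw [sum_xr hι (fun j => ∑ k, ∑ l, (1 - xr ι k) * (1 - xr ι l) * R i j k l ^ 2)]
      simp_rw [Finset.mul_sum]
      refine Finset.sum_congr rfl fun j _ => Finset.sum_congr rfl fun k _ =>
        Finset.sum_congr rfl fun l _ => by ring
    simp_rw [h1]
    rw [← sum_xr hι (fun i => ∑ b, ∑ k, ∑ l, (1 - xr ι k) * (1 - xr ι l) * R i (ι b) k l ^ 2)]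
    simp_rw [Finset.mul_sum]
    refine Finset.sum_congr rfl fun a _ => Finset.sum_congr rfl fun b _ =>
      Finset.sum_congr rfl fun p _ => Finset.sum_congr rfl fun q _ => ?_
    rcases eq_or_ne a b with rfl | hab
    · rw [z1]; ring
    have : -2 * ((1 - xr ι p) * (1 - xr ι q) * R (ι a) (ι b) p q ^ 2) =
      (1 - xr ι p) * ((1 - xr ι q) * (-2 * R (ι a) (ι b) p q ^ 2)) := by ring
    rw [this, mul_assoc]
    refine xr_cases ι fun hp => xr_cases ι fun hq => ?_
    rw [M_two hskew₁ hskew₂ hbianchi hμ hι m1 m2 hab hp hq, hpair p q]; ring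
  rw [t1, t2]; ring

end Mu

end Tuples

section Counting

variable {n : ℕ}

lemma card_between (ν : ℕ) (P Q : Finset (Fin n)) (hPQ : Disjoint P Q) (hP : P.card ≤ ν) :
    ((Finset.powersetCard ν (Finset.univ : Finset (Fin n))).filter
      (fun s => P ⊆ s ∧ Disjoint s Q)).card = (n - (P.card + Q.card)).choose (ν - P.card) := by
  have h1 : ((P ∪ Q)ᶜ : Finset (Fin n)).card = n - (P.card + Q.card) := by
    rw [Finset.card_compl, Finset.card_union_of_disjoint hPQ, Fintype.card_fin]
  rw [← h1, ← Finset.card_powersetCard]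
  refine Finset.card_nbij' (fun s => s \ P) (fun t => t ∪ P) ?_ ?_ ?_ ?_
  · intro s hs
    simp only [Finset.coe_filter, Finset.mem_powersetCard, Set.mem_setOf_eq] at hs
    obtain ⟨⟨-, hc⟩, hsub, hd⟩ := hs
    simp only [Finset.mem_coe, Finset.mem_powersetCard]
    refine ⟨?_, by rw [Finset.card_sdiff_of_subset hsub, hc]⟩
    intro x hx
    rw [Finset.mem_sdiff] at hx
    simp only [Finset.mem_compl, Finset.mem_union, not_or]
    exact ⟨hx.2, Finset.disjoint_left.1 hd hx.1⟩
  · intro t ht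
    simp only [Finset.mem_coe, Finset.mem_powersetCard] at ht
    have hd : Disjoint t (P ∪ Q) := by
      rw [← Finset.subset_compl_iff_disjoint_right]; exact ht.1
    rw [Finset.disjoint_union_right] at hd
    simp only [Finset.coe_filter, Finset.mem_powersetCard, Set.mem_setOf_eq]
    refine ⟨⟨Finset.subset_univ _, ?_⟩, Finset.subset_union_right, ?_⟩
    · rw [Finset.card_union_of_disjoint hd.1, ht.2]; omega
    · rw [Finset.disjoint_union_left]; exact ⟨hd.2, hPQ⟩
  · intro s hs
    simp only [Finset.coe_filter, Finset.mem_powersetCard, Set.mem_setOf_eq] at hs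
    exact Finset.sdiff_union_of_subset hs.2.1
  · intro t ht
    simp only [Finset.mem_coe, Finset.mem_powersetCard] at ht
    have hd : Disjoint t (P ∪ Q) := by
      rw [← Finset.subset_compl_iff_disjoint_right]; exact ht.1
    rw [Finset.disjoint_union_right] at hd
    exact Finset.union_sdiff_cancel_right hd.1

lemma chooseZ_nat (m k : ℕ) : chooseZ m k = (m.choose k : ℤ) := by
  unfold chooseZ
  split_ifs with h
  · simp
  · rw [Nat.choose_eq_zero_of_lt (by omega)]; rfl

lemma card_chooseZ (ν : ℕ) (P Q : Finset (Fin n)) (hPQ : Disjoint P Q) :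
    (((Finset.powersetCard ν (Finset.univ : Finset (Fin n))).filter
      (fun s => P ⊆ s ∧ Disjoint s Q)).card : ℤ) =
      chooseZ ((n : ℤ) - ((P.card + Q.card : ℕ) : ℤ)) ((ν : ℤ) - (P.card : ℤ)) := by
  have hn : P.card + Q.card ≤ n := by
    rw [← Finset.card_union_of_disjoint hPQ]
    simpa using Finset.card_le_univ (P ∪ Q)
  by_cases hP : P.card ≤ ν
  · rw [card_between ν P Q hPQ hP, ← Nat.cast_sub hn, ← Nat.cast_sub hP, chooseZ_nat]
  · rw [chooseZ, if_neg (by omega), Nat.cast_eq_zero, Finset.card_eq_zero,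
      Finset.filter_eq_empty_iff]
    intro s hs h
    rw [Finset.mem_powersetCard] at hs
    have := Finset.card_le_card h.1
    omega

/-- Indicator of membership. -/
def ind (s : Finset (Fin n)) (i : Fin n) : ℝ := if i ∈ s then 1 else 0

lemma sum_ind (ν : ℕ) (P Q : Finset (Fin n)) (hPQ : Disjoint P Q)
    (f : Finset (Fin n) → ℝ) (hf : ∀ s, f s = if P ⊆ s ∧ Disjoint s Q then 1 else 0) :
    ∑ s : Set.powersetCard (Fin n) ν, f s.val =
      (chooseZ ((n : ℤ) - ((P.card + Q.card : ℕ) : ℤ)) ((ν : ℤ) - (P.card : ℤ)) : ℝ) := by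
  rw [← card_chooseZ ν P Q hPQ, Int.cast_natCast]
  have := Finset.sum_subtype (p := fun s => s ∈ Set.powersetCard (Fin n) ν)
    (F := inferInstanceAs (Fintype (Set.powersetCard (Fin n) ν)))
    (Finset.powersetCard ν (Finset.univ : Finset (Fin n)))
    (fun s => by simp [Set.powersetCard]) f
  rw [Finset.card_filter, Nat.cast_sum]
  refine this.symm.trans ?_
  refine Finset.sum_congr rfl fun s _ => ?_
  rw [hf]; split_ifs <;> simp

lemma count_one (ν : ℕ) (i j : Fin n) (hij : i ≠ j) :
    ∑ s : Set.powersetCard (Fin n) ν, ind s.val i * (1 - ind s.val j) =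
      (chooseZ ((n : ℤ) - 2) ((ν : ℤ) - 1) : ℝ) := by
  refine (sum_ind ν {i} {j} (by simpa using hij) (fun s => ind s i * (1 - ind s j)) ?_).trans ?_
  · intro s
    simp only [ind, Finset.singleton_subset_iff, Finset.disjoint_singleton_right]
    by_cases h1 : i ∈ s <;> by_cases h2 : j ∈ s <;> simp [h1, h2]
  · simp

lemma count_two (ν : ℕ) (i j k l : Fin n) (hij : i ≠ j) (hkl : k ≠ l) (hik : i ≠ k)
    (hil : i ≠ l) (hjk : j ≠ k) (hjl : j ≠ l) :
    ∑ s : Set.powersetCard (Fin n) ν,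
      ind s.val i * ind s.val j * (1 - ind s.val k) * (1 - ind s.val l) =
      (chooseZ ((n : ℤ) - 4) ((ν : ℤ) - 2) : ℝ) := by
  refine (sum_ind ν {i, j} {k, l} ?_
    (fun s => ind s i * ind s j * (1 - ind s k) * (1 - ind s l)) ?_).trans ?_
  · simp [hik.symm, hil.symm, hjk.symm, hjl.symm]
  · intro s
    simp only [ind, Finset.insert_subset_iff, Finset.singleton_subset_iff,
      Finset.disjoint_insert_right, Finset.disjoint_singleton_right]
    by_cases h1 : i ∈ s <;> by_cases h2 : j ∈ s <;> by_cases h3 : k ∈ s <;>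
      by_cases h4 : l ∈ s <;> simp [h1, h2, h3, h4]
  · rw [Finset.card_pair hij, Finset.card_pair hkl]; norm_num

end Counting

section TraceLink

variable {n ν : ℕ}

lemma stdWedge_eq (κ : Fin ν → Fin n) :
    stdWedge n ν κ = exteriorPower.ιMulti ℝ ν (fun a => Pi.single (κ a) (1 : ℝ)) := rfl

lemma alt_of_linear (φ : ⋀[ℝ]^ν (Fin n → ℝ) →ₗ[ℝ] ℝ) :
    Alt (fun κ => φ (stdWedge n ν κ)) := by
  refine ⟨fun κ c d hcd h => ?_, fun κ c d hcd => ?_⟩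
  · change φ (stdWedge n ν κ) = 0
    rw [stdWedge_eq, AlternatingMap.map_eq_zero_of_eq _ _ (by simp [h]) hcd, map_zero]
  · change φ (stdWedge n ν (κ ∘ Equiv.swap c d)) = - φ (stdWedge n ν κ)
    rw [stdWedge_eq, stdWedge_eq, ← map_neg,
      ← AlternatingMap.map_swap (exteriorPower.ιMulti ℝ ν)
        (fun a => (Pi.single (κ a) (1 : ℝ) : Fin n → ℝ)) hcd]
    rfl

lemma map_AnuVal (φ : ⋀[ℝ]^ν (Fin n → ℝ) →ₗ[ℝ] ℝ)
    (R : Fin n → Fin n → Fin n → Fin n → ℝ) (κ : Fin ν → Fin n) :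
    φ (AnuVal n ν R κ) = opA R (fun κ => φ (stdWedge n ν κ)) κ := by
  simp only [AnuVal, opA, map_sub, map_sum, map_smul, smul_eq_mul]
  congr 2
  refine Finset.sum_congr rfl fun a _ => Finset.sum_congr rfl fun b _ => ?_
  split_ifs
  · simp only [map_sum, map_smul, smul_eq_mul]
  · exact map_zero φ

lemma xr_eq_ind (s : Set.powersetCard (Fin n) ν) (i : Fin n) :
    xr (Set.powersetCard.ofFinEmbEquiv.symm s) i = ind s.val i := by
  have := Set.powersetCard.mem_range_ofFinEmbEquiv_symm_iff_mem s i
  rw [Set.mem_range] at this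
  have h2 : (∃ a, (Set.powersetCard.ofFinEmbEquiv.symm s) a = i) ↔ i ∈ s.val := this
  unfold xr ind
  by_cases h : i ∈ s.val
  · rw [if_pos h, if_pos (h2.2 h)]
  · rw [if_neg h, if_neg (fun hh => h (h2.1 hh))]

end TraceLink
/-- Formula (7.7) of the paper:
`Tr A_ν² = C(n-4, ν-2)·S² + [C(n-2, ν-1) − 4·C(n-4, ν-2)]·|Ric|² + C(n-4, ν-2)·|R|²`. -/
theorem trace_Anu_sq (n ν : ℕ) (hn : 1 ≤ n) (hν : ν ≤ n)
    (R : Fin n → Fin n → Fin n → Fin n → ℝ)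
    (hskew₁ : ∀ i j k l, R i j k l = - R j i k l)
    (hskew₂ : ∀ i j k l, R i j k l = - R i j l k)
    (hpair : ∀ i j k l, R i j k l = R k l i j)
    (hbianchi : ∀ i j k l, R i j k l + R i k l j + R i l j k = 0)
    (A : ⋀[ℝ]^ν (Fin n → ℝ) →ₗ[ℝ] ⋀[ℝ]^ν (Fin n → ℝ))
    (hA : ∀ ι : Fin ν → Fin n, A (stdWedge n ν ι) = AnuVal n ν R ι) :
    LinearMap.trace ℝ _ (A ∘ₗ A) =
      (chooseZ ((n : ℤ) - 4) ((ν : ℤ) - 2) : ℝ) * (scalarCurv n R) ^ 2 +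
        ((chooseZ ((n : ℤ) - 2) ((ν : ℤ) - 1) : ℝ) -
            4 * (chooseZ ((n : ℤ) - 4) ((ν : ℤ) - 2) : ℝ)) *
          (∑ i : Fin n, ∑ j : Fin n, (ricci n R i j) ^ 2) +
        (chooseZ ((n : ℤ) - 4) ((ν : ℤ) - 2) : ℝ) *
          (∑ i : Fin n, ∑ j : Fin n, ∑ k : Fin n, ∑ l : Fin n, (R i j k l) ^ 2) := by
  classical
  set e := Pi.basisFun ℝ (Fin n) with he
  set B := e.exteriorPower ν with hB
  rw [LinearMap.trace_eq_matrix_trace ℝ B, Matrix.trace]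
  have key : ∀ s : Set.powersetCard (Fin n) ν,
      (LinearMap.toMatrix B B (A ∘ₗ A)).diag s =
      (∑ i, ∑ j, ind s.val i * (1 - ind s.val j) * R i j i j) ^ 2
      + ∑ i, ∑ p, ind s.val i * (1 - ind s.val p) *
          (∑ k, (1 - 2 * ind s.val k) * R i k p k) ^ 2
      + ∑ i, ∑ j, ∑ k, ∑ l, ind s.val i * ind s.val j * (1 - ind s.val k) *
          (1 - ind s.val l) * R i j k l ^ 2 := by
    intro s
    set φ := exteriorPower.ιMultiDual ℝ ν e s with hφ
    let ι : Fin ν → Fin n := Set.powersetCard.ofFinEmbEquiv.symm s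
    have hι : Function.Injective ι := (Set.powersetCard.ofFinEmbEquiv.symm s).injective
    have hb : exteriorPower.ιMulti_family ℝ ν e s = stdWedge n ν ι := by
      rw [exteriorPower.ιMulti_family, stdWedge_eq]
      congr 1
      funext a
      simp [he, ι]
    have hM : (fun κ => (φ ∘ₗ A) (stdWedge n ν κ)) = opA R (fun κ => φ (stdWedge n ν κ)) := by
      funext κ
      rw [LinearMap.comp_apply, hA, map_AnuVal]
    have hd : (LinearMap.toMatrix B B (A ∘ₗ A)).diag s =
        opA R (opA R (fun κ => φ (stdWedge n ν κ))) ι := by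
      rw [Matrix.diag_apply, LinearMap.toMatrix_apply, hB, exteriorPower.basis_repr_apply,
        exteriorPower.basis_apply, hb, LinearMap.comp_apply, hA, ← hM, ← map_AnuVal,
        LinearMap.comp_apply]
    have hμ : Alt (fun κ => φ (stdWedge n ν κ)) := alt_of_linear φ
    have hM' : Alt (opA R (fun κ => φ (stdWedge n ν κ))) := hM ▸ alt_of_linear (φ ∘ₗ A)
    rw [hd, per_set hskew₁ hskew₂ hpair hbianchi hμ hM' hι]
    · simp only [ι, xr_eq_ind]
    · change φ (stdWedge n ν ι) = 1
      rw [← hb, hφ, exteriorPower.ιMultiDual_apply_diag]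
    · intro κ c hc
      change φ (stdWedge n ν κ) = 0
      rw [stdWedge_eq, hφ, exteriorPower.ιMultiDual_apply_ιMulti]
      refine Matrix.det_eq_zero_of_row_eq_zero c fun j => ?_
      have hj : ι j ≠ κ c := fun h => hc ⟨j, h⟩
      simp only [he, Matrix.of_apply, Module.Basis.coord_apply, Pi.basisFun_repr]
      exact Pi.single_eq_of_ne hj _
  rw [Finset.sum_congr rfl fun s _ => key s]
  exact sum_total (fun s : Set.powersetCard (Fin n) ν => ind s.val)
    (fun s i => by simp only [ind]; split_ifs <;> simp) _ _ (count_one ν) (count_two ν) R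
    hskew₁ hskew₂
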